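/- For open MDPs 𝒜, ℬ: the family of achievable sets of the sum 𝒜⊕ℬ equals the family of achievable sets of D(A^𝒜)⊕D(A^ℬ); that is, for every entrance i of 𝒜⊕ℬ, A^{𝒜⊕ℬ}(i) = A^{D(A^𝒜)⊕D(A^ℬ)}(i), where A^𝒜 and A^ℬ are the families of achievable sets of 𝒜 and ℬ and D(·) denotes the shortcut oMDP construction. -/

import Mathlib

open scoped Classical ENNReal

namespace SD

/-- A Markov decision process with finite sets of states and actions: a partial
transition function assigning to a state and an action a probability
distribution over states. -/
structure MDP (S A : Type) : Type where
  P : S → A → Option (S → ℝ)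

namespace MDP

variable {S A : Type} [Fintype S] [Fintype A]

/-- All defined transitions are genuine probability distributions. -/
def Proper (M : MDP S A) : Prop :=
  ∀ s a d, M.P s a = some d → (∀ s', 0 ≤ d s') ∧ ∑ s', d s' = 1

/-- The action `a` is enabled in `s`. -/
def enabled (M : MDP S A) (s : S) (a : A) : Prop := M.P s a ≠ none

/-- A state is terminal if no action is enabled in it. -/
def terminal (M : MDP S A) (s : S) : Prop := ∀ a, M.P s a = none

/-- Transition probabilities. -/
noncomputable def prob (M : MDP S A) (s : S) (a : A) (s' : S) : ℝ :=
  (M.P s a).elim 0 fun d => d s'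

end MDP

/-- A finite path of an MDP: a start state with a list of (action, next state) steps. -/
structure FinPath (S A : Type) : Type where
  start : S
  steps : List (A × S)

namespace FinPath

/-- The last state of a finite path. -/
def last {S A : Type} (π : FinPath S A) : S := (π.steps.map Prod.snd).getLastD π.start

/-- Extending a finite path by one step. -/
def snoc {S A : Type} (π : FinPath S A) (a : A) (s : S) : FinPath S A :=
  ⟨π.start, π.steps ++ [(a, s)]⟩

end FinPath

namespace MDP

variable {S A : Type} [Fintype S] [Fintype A]

/-- Consistency of a sequence of steps with the transitions, from a given state. -/
def ConsistentFrom (M : MDP S A) : S → List (A × S) → Prop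
  | _, [] => True
  | s, (a, s') :: l => M.prob s a s' ≠ 0 ∧ ConsistentFrom M s' l

/-- A finite path is consistent if every step has nonzero probability. -/
def Consistent (M : MDP S A) (π : FinPath S A) : Prop := M.ConsistentFrom π.start π.steps

end MDP

/-- A (history-dependent, stochastic) scheduler, given by its raw weights. -/
abbrev Sched (S A : Type) : Type := FinPath S A → A → ℝ

namespace MDP

variable {S A : Type} [Fintype S] [Fintype A]

/-- `σ` is a scheduler for `M`: it assigns to every (consistent) finite path a
probability distribution over the actions enabled in its last state. -/
def IsSched (M : MDP S A) (σ : Sched S A) : Prop :=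
  ∀ π : FinPath S A, M.Consistent π →
    (∀ a, 0 ≤ σ π a) ∧ (∀ a, σ π a ≠ 0 → M.enabled π.last a) ∧
      (¬M.terminal π.last → ∑ a, σ π a = 1)

end MDP

/-- Memoryless schedulers depend only on the last state of a path. -/
def Memoryless {S A : Type} (σ : Sched S A) : Prop :=
  ∀ π π' : FinPath S A, π.last = π'.last → σ π = σ π'

/-- Deterministic schedulers choose Dirac distributions. -/
def Deterministic {S A : Type} (σ : Sched S A) : Prop := ∀ π a, σ π a = 0 ∨ σ π a = 1

/-- Deterministic memoryless (DM) schedulers. -/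
def DM {S A : Type} (σ : Sched S A) : Prop := Memoryless σ ∧ Deterministic σ

namespace MDP

variable {S A : Type} [Fintype S] [Fintype A]

/-- Probability of visiting `T` within `n` steps (terminal states made absorbing),
starting from the history `π`, under the scheduler `σ`. -/
noncomputable def reachN (M : MDP S A) (σ : Sched S A) (T : Set S) :
    ℕ → FinPath S A → ℝ
  | 0, π => if π.last ∈ T then 1 else 0
  | n + 1, π =>
      if π.last ∈ T then 1
      else ∑ a : A, σ π a * ∑ s' : S, M.prob π.last a s' * reachN M σ T n (π.snoc a s')

/-- `Pr^{M,σ}(s ⊨ ◇T)`: the probability, under the measure on infinite paths induced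
by `σ` from `s` (terminal states made absorbing), of the paths that visit `T`; it is
the supremum of the bounded-horizon reachability probabilities. -/
noncomputable def Pr (M : MDP S A) (σ : Sched S A) (s : S) (T : Set S) : ℝ :=
  ⨆ n : ℕ, M.reachN σ T n ⟨s, []⟩

end MDP

/-- An open MDP: an MDP together with (totally ordered, given as lists) sets of
rightward/leftward entrances and exits. -/
structure OMDP (S A : Type) : Type where
  M : MDP S A
  Ir : List S
  Il : List S
  Or : List S
  Ol : List S

namespace OMDP

variable {S A : Type}

/-- The entrances `I = I_r ∪ I_l`. -/
def entr (𝒜 : OMDP S A) : List S := 𝒜.Ir ++ 𝒜.Il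

/-- The exits `O = O_r ∪ O_l`. -/
def exit (𝒜 : OMDP S A) : List S := 𝒜.Or ++ 𝒜.Ol

/-- The index type of exits. -/
abbrev ExitIdx (𝒜 : OMDP S A) : Type := {s : S // s ∈ 𝒜.exit}

/-- The index type of entrances. -/
abbrev EntrIdx (𝒜 : OMDP S A) : Type := {s : S // s ∈ 𝒜.entr}

variable [Fintype S] [Fintype A]

/-- Well-formedness of an open MDP: the transitions are probability
distributions, the open ends are pairwise disjoint (each without duplicates),
and the exits are exactly the terminal states. -/
def WF (𝒜 : OMDP S A) : Prop :=
  𝒜.M.Proper ∧ (𝒜.Ir ++ 𝒜.Il ++ 𝒜.Or ++ 𝒜.Ol).Nodup ∧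
    ∀ s : S, s ∈ 𝒜.exit ↔ 𝒜.M.terminal s

/-- `Pr^{𝒜,σ}(i ⊨ ◇O) ∈ ℝ^O`: the vector of reachability probabilities to each exit. -/
noncomputable def prVec (𝒜 : OMDP S A) (σ : Sched S A) (i : S) : 𝒜.ExitIdx → ℝ :=
  fun j => 𝒜.M.Pr σ i {j.1}

/-- The set `A^𝒜(i)` of achievable points from `i`. -/
def achievable (𝒜 : OMDP S A) (i : S) : Set (𝒜.ExitIdx → ℝ) :=
  {p | ∃ σ : Sched S A, 𝒜.M.IsSched σ ∧ p ≤ 𝒜.prVec σ i}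

/-- The set `A^{𝒜,Σ}(i)` of points achievable from `i` by schedulers in the class `C`. -/
def achievableBy (𝒜 : OMDP S A) (i : S) (C : Sched S A → Prop) : Set (𝒜.ExitIdx → ℝ) :=
  {p | ∃ σ : Sched S A, 𝒜.M.IsSched σ ∧ C σ ∧ p ≤ 𝒜.prVec σ i}

/-- The Pareto curve `𝒮(𝒜, i)`: achievable points not strictly dominated by an
achievable point. -/
def pareto (𝒜 : OMDP S A) (i : S) : Set (𝒜.ExitIdx → ℝ) :=
  {p | p ∈ 𝒜.achievable i ∧ ∀ q ∈ 𝒜.achievable i, p ≤ q → q = p}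

end OMDP

/-- Downward closure. -/
def dw {ι : Type} (X : Set (ι → ℝ)) : Set (ι → ℝ) := {p | ∃ q ∈ X, p ≤ q}

/-- Downward convex closure. -/
def dwConv {ι : Type} (X : Set (ι → ℝ)) : Set (ι → ℝ) := dw (convexHull ℝ X)

/-- Subdistributions on `ι`: nonnegative points with coordinate sum at most 1. -/
def Subdist {ι : Type} [Fintype ι] (p : ι → ℝ) : Prop :=
  (∀ j, 0 ≤ p j) ∧ ∑ j, p j ≤ 1

end SD

namespace SD

namespace OMDP

variable {S A : Type} [Fintype S] [Fintype A]

/-- The actions of a shortcut oMDP for the family `B`: the union of the `B i`. -/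
abbrev ShortAct (𝒜 : OMDP S A) (B : 𝒜.EntrIdx → Finset (𝒜.ExitIdx → ℝ)) : Type :=
  {p : 𝒜.ExitIdx → ℝ // ∃ i, p ∈ B i}

noncomputable instance instFintypeShortAct (𝒜 : OMDP S A)
    (B : 𝒜.EntrIdx → Finset (𝒜.ExitIdx → ℝ)) : Fintype (ShortAct 𝒜 B) := by
  have h : {p : 𝒜.ExitIdx → ℝ | ∃ i, p ∈ B i}.Finite := by
    have he : {p : 𝒜.ExitIdx → ℝ | ∃ i, p ∈ B i} =
        ⋃ i, ((B i : Finset (𝒜.ExitIdx → ℝ)) : Set (𝒜.ExitIdx → ℝ)) := by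
      ext p; simp
    rw [he]
    exact Set.finite_iUnion fun i => (B i).finite_toSet
  exact h.fintype

/-- The shortcut oMDP `D(B)` of a family `B = (B_i)_{i ∈ I}` of finite sets of
subdistributions on the exits: states are the entrances and exits of `𝒜`
together with a fresh sink `⋆` (encoded by `Option S`, with `⋆ = none`), actions
are the points in the `B_i`, and from entrance `i` the action `p ∈ B_i` moves to
exit `o` with probability `p(o)` and to `⋆` with the remaining probability
`1 - Σ_o p(o)`. -/
noncomputable def shortcut (𝒜 : OMDP S A) (B : 𝒜.EntrIdx → Finset (𝒜.ExitIdx → ℝ)) :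
    OMDP (Option S) (ShortAct 𝒜 B) where
  M := ⟨fun t a =>
    match t with
    | none => none
    | some s =>
        if _h : ∃ hs : s ∈ 𝒜.entr, a.1 ∈ B ⟨s, hs⟩ then
          some fun t' =>
            match t' with
            | none => 1 - ∑ j : 𝒜.ExitIdx, a.1 j
            | some s' => ∑ j : 𝒜.ExitIdx, if j.1 = s' then a.1 j else 0
        else none⟩
  Ir := 𝒜.Ir.map some
  Il := 𝒜.Il.map some
  Or := 𝒜.Or.map some
  Ol := 𝒜.Ol.map some

end OMDP

/-- Transporting points in `ℝ^{O_𝒴}` to points in `ℝ^{O_𝒳}` along a map of exits. -/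
def pullExit {S₁ A₁ S₂ A₂ : Type} (𝒳 : OMDP S₁ A₁) (𝒴 : OMDP S₂ A₂) (f : S₁ → S₂)
    (hf : ∀ s ∈ 𝒳.exit, f s ∈ 𝒴.exit) (p : 𝒴.ExitIdx → ℝ) : 𝒳.ExitIdx → ℝ :=
  fun j => p ⟨f j.1, hf j.1 j.2⟩

end SD

namespace SD

namespace OMDP

variable {S₁ A₁ S₂ A₂ : Type}

/-- The sum `𝒜 ⊕ ℬ` of open MDPs: the disjoint union of the two oMDPs, with
transitions inherited from each component (and none between components), and
open ends the concatenations of the respective open ends. -/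
def sumComp (𝒜 : OMDP S₁ A₁) (ℬ : OMDP S₂ A₂) : OMDP (S₁ ⊕ S₂) (A₁ ⊕ A₂) where
  M := ⟨fun t a =>
    match t, a with
    | Sum.inl s, Sum.inl a => (𝒜.M.P s a).map fun d => Sum.elim d fun _ => 0
    | Sum.inr s, Sum.inr a => (ℬ.M.P s a).map fun d => Sum.elim (fun _ => 0) d
    | _, _ => none⟩
  Ir := 𝒜.Ir.map Sum.inl ++ ℬ.Ir.map Sum.inr
  Il := 𝒜.Il.map Sum.inl ++ ℬ.Il.map Sum.inr
  Or := 𝒜.Or.map Sum.inl ++ ℬ.Or.map Sum.inr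
  Ol := 𝒜.Ol.map Sum.inl ++ ℬ.Ol.map Sum.inr

end OMDP

end SD

namespace SD

namespace FinPath

variable {S A S' A' : Type}

/-- The image of a finite path under maps of states and actions. -/
def map (f : S → S') (g : A → A') (π : FinPath S A) : FinPath S' A' :=
  ⟨f π.start, π.steps.map (Prod.map g f)⟩

theorem last_snoc (π : FinPath S A) (a : A) (s : S) : (π.snoc a s).last = s := by
  simp [last, snoc, List.getLastD_eq_getLast?]

theorem map_snoc (f : S → S') (g : A → A') (π : FinPath S A) (a : A) (s : S) :
    (π.snoc a s).map f g = (π.map f g).snoc (g a) (f s) := by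
  simp [map, snoc]

theorem last_map (f : S → S') (g : A → A') (π : FinPath S A) :
    (π.map f g).last = f π.last := by
  obtain ⟨s, l⟩ := π
  rcases List.eq_nil_or_concat l with rfl | ⟨l, x, rfl⟩
  · rfl
  · simp [last, map, List.getLastD_eq_getLast?]

theorem map_injective {f : S → S'} {g : A → A'} (hf : f.Injective) (hg : g.Injective) :
    (map f g).Injective := by
  rintro ⟨s, l⟩ ⟨t, m⟩ h
  simp only [map, mk.injEq] at h
  rw [hf h.1, List.map_injective_iff.2 (hg.prodMap hf) h.2]

end FinPath

namespace MDP

theorem prob_eq_zero_of_not_enabled {S A : Type} {M : MDP S A} {s : S} {a : A}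
    (h : ¬M.enabled s a) (t : S) : M.prob s a t = 0 := by
  simp only [enabled, not_not] at h
  simp [prob, h]

/-- Maps of states and actions embedding `M` into `N` as a part that transitions of `N`
never leave. -/
structure IsClosedEmbedding {S A S' A' : Type} (M : MDP S A) (N : MDP S' A')
    (f : S → S') (g : A → A') : Prop where
  state_injective : f.Injective
  action_injective : g.Injective
  prob_map : ∀ s a t, N.prob (f s) (g a) (f t) = M.prob s a t
  prob_of_notMem_range : ∀ s b t, t ∉ Set.range f → N.prob (f s) b t = 0
  enabled_map : ∀ s a, N.enabled (f s) (g a) ↔ M.enabled s a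
  not_enabled_of_notMem_range : ∀ s b, b ∉ Set.range g → ¬N.enabled (f s) b

variable {S A S' A' : Type}

theorem exists_isSched [Fintype A] (M : MDP S A) : ∃ σ : Sched S A, M.IsSched σ := by
  have h : ∀ s : S, ∃ w : A → ℝ, (∀ a, 0 ≤ w a) ∧ (∀ a, w a ≠ 0 → M.enabled s a) ∧
      (¬M.terminal s → ∑ a, w a = 1) := by
    intro s
    by_cases hs : M.terminal s
    · exact ⟨0, by simp, by simp, fun h => absurd hs h⟩
    · simp only [terminal, not_forall] at hs
      obtain ⟨a, ha⟩ := hs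
      refine ⟨Pi.single a 1, fun b => ?_, fun b hb => ?_, fun _ => by simp⟩
      · by_cases hb : b = a <;> simp [hb]
      · by_cases hba : b = a
        · exact hba ▸ ha
        · simp [hba] at hb
  choose w hw using h
  exact ⟨fun π => w π.last, fun π _ => hw _⟩

theorem reachN_empty [Fintype S] [Fintype A] (M : MDP S A) (σ : Sched S A) (n : ℕ)
    (π : FinPath S A) :
    M.reachN σ ∅ n π = 0 := by
  induction n generalizing π with
  | zero => simp [reachN]
  | succ n ih => simp [reachN, ih]

theorem reachN_of_terminal [Fintype S] [Fintype A] {M : MDP S A} (σ : Sched S A)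
    (T : Set S) (n : ℕ) {π : FinPath S A} (h : M.terminal π.last) :
    M.reachN σ T n π = if π.last ∈ T then 1 else 0 := by
  cases n with
  | zero => rfl
  | succ n =>
    have h0 : ∀ a t, M.prob π.last a t = 0 := fun a t => by simp [prob, h a]
    simp [reachN, h0]

namespace IsClosedEmbedding

variable {M : MDP S A} {N : MDP S' A'} {f : S → S'} {g : A → A'}

theorem terminal_iff (h : M.IsClosedEmbedding N f g) (s : S) :
    N.terminal (f s) ↔ M.terminal s := by
  constructor
  · intro ht a
    by_contra ha
    exact (h.enabled_map s a).2 ha (ht _)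
  · intro ht b
    by_contra hb
    by_cases hr : b ∈ Set.range g
    · obtain ⟨a, rfl⟩ := hr
      exact (h.enabled_map s a).1 hb (ht a)
    · exact h.not_enabled_of_notMem_range s b hr hb

theorem consistent_map_iff (h : M.IsClosedEmbedding N f g) (π : FinPath S A) :
    N.Consistent (π.map f g) ↔ M.Consistent π := by
  obtain ⟨s, l⟩ := π
  simp only [Consistent, FinPath.map]
  induction l generalizing s with
  | nil => simp [ConsistentFrom]
  | cons x l ih => simp [ConsistentFrom, Prod.map, h.prob_map, ih]

theorem reachN_map [Fintype S] [Fintype A] [Fintype S'] [Fintype A']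
    (h : M.IsClosedEmbedding N f g) (σ : Sched S' A') (T : Set S') (n : ℕ)
    (π : FinPath S A) :
    N.reachN σ T n (π.map f g) =
      M.reachN (fun π a => σ (π.map f g) (g a)) (f ⁻¹' T) n π := by
  induction n generalizing π with
  | zero => simp [reachN, FinPath.last_map]
  | succ n ih =>
    simp only [reachN, FinPath.last_map, Set.mem_preimage]
    congr 1
    symm
    refine Fintype.sum_of_injective g h.action_injective _ _ (fun b hb => ?_) fun a => ?_
    · simp [prob_eq_zero_of_not_enabled (h.not_enabled_of_notMem_range _ b hb)]
    · congr 1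
      refine Fintype.sum_of_injective f h.state_injective _ _ (fun t ht => ?_) fun t => ?_
      · simp [h.prob_of_notMem_range _ _ t ht]
      · rw [h.prob_map, ← FinPath.map_snoc, ih]

theorem Pr_map [Fintype S] [Fintype A] [Fintype S'] [Fintype A']
    (h : M.IsClosedEmbedding N f g) (σ : Sched S' A') (T : Set S') (s : S) :
    N.Pr σ (f s) T = M.Pr (fun π a => σ (π.map f g) (g a)) s (f ⁻¹' T) :=
  iSup_congr fun n => h.reachN_map σ T n ⟨s, []⟩

theorem isSched_comp [Fintype A] [Fintype A']
    (h : M.IsClosedEmbedding N f g) {σ : Sched S' A'} (hσ : N.IsSched σ) :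
    M.IsSched fun π a => σ (π.map f g) (g a) := by
  intro π hπ
  obtain ⟨h0, h1, h2⟩ := hσ _ ((h.consistent_map_iff π).2 hπ)
  rw [FinPath.last_map] at h1 h2
  refine ⟨fun a => h0 _, fun a ha => (h.enabled_map _ _).1 (h1 _ ha), fun ht => ?_⟩
  rw [← h2 fun ht' => ht ((h.terminal_iff _).1 ht')]
  refine Fintype.sum_of_injective g h.action_injective _ _ (fun b hb => ?_) fun a => rfl
  by_contra hne
  exact h.not_enabled_of_notMem_range _ b hb (h1 b hne)

theorem exists_isSched_extend [Fintype A] [Fintype A']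
    (h : M.IsClosedEmbedding N f g) {σ : Sched S A}
    (hσ : M.IsSched σ) :
    ∃ τ : Sched S' A', N.IsSched τ ∧ (fun π a => τ (π.map f g) (g a)) = σ := by
  obtain ⟨ρ, hρ⟩ := N.exists_isSched
  have hmap := FinPath.map_injective h.state_injective h.action_injective
  refine ⟨Function.extend (FinPath.map f g) (fun π => Function.extend g (σ π) 0) ρ, ?_, ?_⟩
  · intro π hπ
    by_cases hr : ∃ π₀, FinPath.map f g π₀ = π
    · obtain ⟨π, rfl⟩ := hr
      obtain ⟨h0, h1, h2⟩ := hσ _ ((h.consistent_map_iff π).1 hπ)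
      rw [hmap.extend_apply, FinPath.last_map]
      have hout : ∀ b, b ∉ Set.range g → Function.extend g (σ π) 0 b = 0 :=
        fun b hb => Function.extend_apply' _ _ _ hb
      refine ⟨fun b => ?_, fun b hb => ?_, fun ht => ?_⟩
      · by_cases hbr : b ∈ Set.range g
        · obtain ⟨a, rfl⟩ := hbr
          rw [h.action_injective.extend_apply]
          exact h0 a
        · exact (hout b hbr).ge
      · by_cases hbr : b ∈ Set.range g
        · obtain ⟨a, rfl⟩ := hbr
          rw [h.action_injective.extend_apply] at hb
          exact (h.enabled_map _ _).2 (h1 a hb)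
        · exact absurd (hout b hbr) hb
      · rw [← h2 fun ht' => ht ((h.terminal_iff _).2 ht')]
        symm
        exact Fintype.sum_of_injective g h.action_injective _ _ hout
          fun a => (h.action_injective.extend_apply _ _ _).symm
    · rw [Function.extend_apply' _ _ _ hr]
      exact hρ π hπ
  · funext π a
    rw [hmap.extend_apply, h.action_injective.extend_apply]

end IsClosedEmbedding

end MDP

namespace OMDP

variable {S A S' A' : Type}

theorem achievable_nonempty [Fintype S] [Fintype A] (𝒜 : OMDP S A) (s : S) :
    (𝒜.achievable s).Nonempty := by
  obtain ⟨σ, hσ⟩ := 𝒜.M.exists_isSched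
  exact ⟨_, σ, hσ, le_rfl⟩

/-- Achievability in an oMDP from a state in a closed part depends only on that part. -/
theorem mem_achievable_of_isClosedEmbedding [Fintype S] [Fintype A] [Fintype S'] [Fintype A']
    {𝒳 : OMDP S A} {𝒵 : OMDP S' A'} {f : S → S'}
    {g : A → A'} (h : 𝒳.M.IsClosedEmbedding 𝒵.M f g)
    (hex : ∀ j, f j ∈ 𝒵.exit ↔ j ∈ 𝒳.exit) (s : S) (p : 𝒵.ExitIdx → ℝ) :
    p ∈ 𝒵.achievable (f s) ↔
      (fun j : 𝒳.ExitIdx => p ⟨f j.1, (hex _).2 j.2⟩) ∈ 𝒳.achievable s ∧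
        ∀ o : 𝒵.ExitIdx, o.1 ∉ Set.range f → p o ≤ 0 := by
  have hin : ∀ (σ : Sched S' A') (j : S), 𝒵.M.Pr σ (f s) {f j} =
      𝒳.M.Pr (fun π a => σ (π.map f g) (g a)) s {j} := by
    intro σ j
    rw [h.Pr_map]
    congr 1
    ext t
    simp [h.state_injective.eq_iff]
  have hout : ∀ (σ : Sched S' A') (o : S'), o ∉ Set.range f → 𝒵.M.Pr σ (f s) {o} = 0 := by
    intro σ o ho
    have he : f ⁻¹' {o} = ∅ := by
      ext t
      simpa using fun hh => ho ⟨t, hh⟩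
    rw [h.Pr_map, he]
    simp [MDP.Pr, MDP.reachN_empty]
  constructor
  · rintro ⟨σ, hσ, hp⟩
    refine ⟨⟨_, h.isSched_comp hσ, fun j => ?_⟩, fun o ho => ?_⟩
    · exact (hp _).trans_eq (hin σ j.1)
    · exact (hp o).trans_eq (hout σ o.1 ho)
  · rintro ⟨⟨σ, hσ, hp⟩, hq⟩
    obtain ⟨τ, hτ, rfl⟩ := h.exists_isSched_extend hσ
    refine ⟨τ, hτ, ?_⟩
    rintro ⟨o, ho⟩
    by_cases hr : o ∈ Set.range f
    · obtain ⟨j, rfl⟩ := hr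
      exact (hp ⟨j, (hex j).1 ho⟩).trans_eq (hin τ j).symm
    · exact (hq _ hr).trans_eq (hout τ o hr).symm

section Sum

variable {S₁ A₁ S₂ A₂ : Type}

theorem isClosedEmbedding_inl (𝒜 : OMDP S₁ A₁) (ℬ : OMDP S₂ A₂) :
    𝒜.M.IsClosedEmbedding (𝒜.sumComp ℬ).M Sum.inl Sum.inl where
  state_injective := Sum.inl_injective
  action_injective := Sum.inl_injective
  prob_map s a t := by
    cases hP : 𝒜.M.P s a <;> simp [MDP.prob, sumComp, hP]
  prob_of_notMem_range s b t ht := by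
    rcases t with t | t
    · exact absurd ⟨t, rfl⟩ ht
    · rcases b with a | b
      · cases hP : 𝒜.M.P s a <;> simp [MDP.prob, sumComp, hP]
      · simp [MDP.prob, sumComp]
  enabled_map s a := by simp [MDP.enabled, sumComp]
  not_enabled_of_notMem_range s b hb := by
    rcases b with a | b
    · exact absurd ⟨a, rfl⟩ hb
    · simp [MDP.enabled, sumComp]

theorem isClosedEmbedding_inr (𝒜 : OMDP S₁ A₁) (ℬ : OMDP S₂ A₂) :
    ℬ.M.IsClosedEmbedding (𝒜.sumComp ℬ).M Sum.inr Sum.inr where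
  state_injective := Sum.inr_injective
  action_injective := Sum.inr_injective
  prob_map s a t := by
    cases hP : ℬ.M.P s a <;> simp [MDP.prob, sumComp, hP]
  prob_of_notMem_range s b t ht := by
    rcases t with t | t
    · rcases b with a | b
      · simp [MDP.prob, sumComp]
      · cases hP : ℬ.M.P s b <;> simp [MDP.prob, sumComp, hP]
    · exact absurd ⟨t, rfl⟩ ht
  enabled_map s a := by simp [MDP.enabled, sumComp]
  not_enabled_of_notMem_range s b hb := by
    rcases b with a | b
    · simp [MDP.enabled, sumComp]
    · exact absurd ⟨b, rfl⟩ hb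

theorem inl_mem_exit_sumComp (𝒜 : OMDP S₁ A₁) (ℬ : OMDP S₂ A₂) (s : S₁) :
    Sum.inl s ∈ (𝒜.sumComp ℬ).exit ↔ s ∈ 𝒜.exit := by
  simp [exit, sumComp]

theorem inr_mem_exit_sumComp (𝒜 : OMDP S₁ A₁) (ℬ : OMDP S₂ A₂) (s : S₂) :
    Sum.inr s ∈ (𝒜.sumComp ℬ).exit ↔ s ∈ ℬ.exit := by
  simp [exit, sumComp]

end Sum

section Shortcut

variable (𝒜 : OMDP S A) (B : 𝒜.EntrIdx → Finset (𝒜.ExitIdx → ℝ))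

theorem some_mem_exit_shortcut (s : S) : some s ∈ (𝒜.shortcut B).exit ↔ s ∈ 𝒜.exit := by
  simp [exit, shortcut]

theorem exists_mem_exit_of_mem_exit_shortcut {t : Option S} (ht : t ∈ (𝒜.shortcut B).exit) :
    ∃ s ∈ 𝒜.exit, some s = t := by
  simp only [exit, shortcut, ← List.map_append, List.mem_map] at ht
  exact ht

theorem enabled_shortcut_iff {s : S} (hs : s ∈ 𝒜.entr) (a : ShortAct 𝒜 B) :
    (𝒜.shortcut B).M.enabled (some s) a ↔ a.1 ∈ B ⟨s, hs⟩ := by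
  simp [MDP.enabled, shortcut, hs]

theorem terminal_shortcut {t : Option S} (ht : ∀ s ∈ 𝒜.entr, t ≠ some s) :
    (𝒜.shortcut B).M.terminal t := by
  intro a
  rcases t with _ | s
  · rfl
  · have hs : s ∉ 𝒜.entr := fun h => ht s h rfl
    simp [shortcut, hs]

theorem prob_shortcut_exit {s : S} (hs : s ∈ 𝒜.entr) (a : ShortAct 𝒜 B) (j : 𝒜.ExitIdx) :
    (𝒜.shortcut B).M.prob (some s) a (some j.1) = if a.1 ∈ B ⟨s, hs⟩ then a.1 j else 0 := by
  by_cases ha : a.1 ∈ B ⟨s, hs⟩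
  · simp [MDP.prob, shortcut, hs, ha, Subtype.val_inj]
  · simp [MDP.prob, shortcut, hs, ha]

theorem prob_shortcut_eq_zero {s t : S} (ht : t ∉ 𝒜.exit) (a : ShortAct 𝒜 B) :
    (𝒜.shortcut B).M.prob (some s) a (some t) = 0 := by
  have h0 : ∀ j : 𝒜.ExitIdx, j.1 ≠ t := fun j hj => ht (hj ▸ j.2)
  by_cases ha : ∃ hs : s ∈ 𝒜.entr, a.1 ∈ B ⟨s, hs⟩
  · simp [MDP.prob, shortcut, ha, h0]
  · simp [MDP.prob, shortcut, ha]

theorem reachN_succ_shortcut [Fintype S] (hdisj : ∀ s ∈ 𝒜.entr, s ∉ 𝒜.exit)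
    (σ : Sched (Option S) (ShortAct 𝒜 B)) {s : S} (hs : s ∈ 𝒜.entr) (j : 𝒜.ExitIdx) (n : ℕ) :
    (𝒜.shortcut B).M.reachN σ {some j.1} (n + 1) ⟨some s, []⟩ =
      ∑ a, if a.1 ∈ B ⟨s, hs⟩ then σ ⟨some s, []⟩ a * a.1 j else 0 := by
  have hlast : FinPath.last (⟨some s, []⟩ : FinPath (Option S) (ShortAct 𝒜 B)) = some s := rfl
  have hne : s ≠ j.1 := fun h => hdisj s hs (h ▸ j.2)
  simp only [MDP.reachN, hlast, Set.mem_singleton_iff, Option.some.injEq, hne, if_false]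
  refine Finset.sum_congr rfl fun a _ => ?_
  rw [Finset.sum_eq_single (some j.1)]
  · have hterm : (𝒜.shortcut B).M.terminal
        ((⟨some s, []⟩ : FinPath (Option S) (ShortAct 𝒜 B)).snoc a (some j.1)).last := by
      rw [FinPath.last_snoc]
      refine 𝒜.terminal_shortcut B fun t ht h => ?_
      exact hdisj t ht (Option.some.inj h ▸ j.2)
    rw [MDP.reachN_of_terminal _ _ _ hterm, FinPath.last_snoc, prob_shortcut_exit _ _ hs]
    simp
  · intro t _ htj
    by_cases hx : ∃ u ∈ 𝒜.entr, t = some u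
    · obtain ⟨u, hu, rfl⟩ := hx
      rw [prob_shortcut_eq_zero _ _ (hdisj u hu), zero_mul]
    · push Not at hx
      have hterm := 𝒜.terminal_shortcut B hx
      rw [← FinPath.last_snoc (⟨some s, []⟩ : FinPath (Option S) (ShortAct 𝒜 B)) a t] at hterm
      rw [MDP.reachN_of_terminal _ _ _ hterm, FinPath.last_snoc]
      simp [htj]
  · simp

theorem sum_shortAct [Fintype S] (k : 𝒜.EntrIdx) (F : (𝒜.ExitIdx → ℝ) → ℝ) :
    (∑ a : ShortAct 𝒜 B, if a.1 ∈ B k then F a.1 else 0) = ∑ p ∈ B k, F p := by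
  rw [← Finset.sum_filter]
  refine Finset.sum_nbij Subtype.val (fun a ha => (Finset.mem_filter.1 ha).2)
    Subtype.val_injective.injOn (fun p hp => ?_) fun _ _ => rfl
  exact ⟨⟨p, k, hp⟩, by simpa using hp, rfl⟩

theorem Pr_shortcut [Fintype S] (hdisj : ∀ s ∈ 𝒜.entr, s ∉ 𝒜.exit)
    (hB : ∀ k, ∀ p ∈ B k, ∀ j, 0 ≤ p j)
    {σ : Sched (Option S) (ShortAct 𝒜 B)} {s : S} (hs : s ∈ 𝒜.entr)
    (hσ : ∀ a, 0 ≤ σ ⟨some s, []⟩ a) (j : 𝒜.ExitIdx) :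
    (𝒜.shortcut B).M.Pr σ (some s) {some j.1} =
      ∑ a, if a.1 ∈ B ⟨s, hs⟩ then σ ⟨some s, []⟩ a * a.1 j else 0 := by
  have hne : s ≠ j.1 := fun h => hdisj s hs (h ▸ j.2)
  have h0 : (𝒜.shortcut B).M.reachN σ {some j.1} 0 ⟨some s, []⟩ = 0 := by
    simp [MDP.reachN, FinPath.last, hne]
  have hsucc := 𝒜.reachN_succ_shortcut B hdisj σ hs j
  set v := ∑ a, if a.1 ∈ B ⟨s, hs⟩ then σ ⟨some s, []⟩ a * a.1 j else 0
  have hv : 0 ≤ v := Finset.sum_nonneg fun a _ => by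
    split_ifs with ha
    · exact mul_nonneg (hσ a) (hB _ _ ha j)
    · exact le_rfl
  have hle : ∀ n, (𝒜.shortcut B).M.reachN σ {some j.1} n ⟨some s, []⟩ ≤ v := by
    rintro (_ | n)
    · exact h0.trans_le hv
    · exact (hsucc n).le
  exact le_antisymm (ciSup_le hle)
    ((hsucc 0).ge.trans (le_ciSup ⟨v, Set.forall_mem_range.2 hle⟩ (0 + 1)))

/-- From an entrance, the shortcut oMDP achieves exactly the downward convex closure of the
family it is built from. -/
theorem mem_achievable_shortcut [Fintype S] (hdisj : ∀ s ∈ 𝒜.entr, s ∉ 𝒜.exit)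
    (hB : ∀ k, ∀ p ∈ B k, ∀ j, 0 ≤ p j) {s : S} (hs : s ∈ 𝒜.entr)
    (hne : (B ⟨s, hs⟩).Nonempty) (q : (𝒜.shortcut B).ExitIdx → ℝ) :
    q ∈ (𝒜.shortcut B).achievable (some s) ↔
      (fun j : 𝒜.ExitIdx => q ⟨some j.1, (𝒜.some_mem_exit_shortcut B _).2 j.2⟩) ∈
        dwConv (B ⟨s, hs⟩ : Set (𝒜.ExitIdx → ℝ)) := by
  have hnt : ¬(𝒜.shortcut B).M.terminal (some s) := by
    obtain ⟨p, hp⟩ := hne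
    intro ht
    exact (𝒜.enabled_shortcut_iff B hs ⟨p, _, hp⟩).2 hp (ht _)
  constructor
  · rintro ⟨σ, hσ, hq⟩
    obtain ⟨h0, h1, h2⟩ := hσ ⟨some s, []⟩ trivial
    set w : (𝒜.ExitIdx → ℝ) → ℝ := Function.extend Subtype.val (σ ⟨some s, []⟩) 0 with hw
    have hwa : ∀ a : ShortAct 𝒜 B, w a.1 = σ ⟨some s, []⟩ a :=
      fun a => Subtype.val_injective.extend_apply _ _ _
    refine ⟨∑ p ∈ B ⟨s, hs⟩, w p • p, Finset.mem_convexHull'.2 ⟨w, fun p hp => ?_, ?_, rfl⟩, ?_⟩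
    · exact (h0 ⟨p, _, hp⟩).trans_eq (hwa ⟨p, _, hp⟩).symm
    · rw [← 𝒜.sum_shortAct B, ← h2 hnt]
      refine Finset.sum_congr rfl fun a _ => ?_
      split_ifs with ha
      · exact hwa a
      · by_contra hc
        exact ha ((𝒜.enabled_shortcut_iff B hs a).1 (h1 a (Ne.symm hc)))
    · intro j
      refine (hq _).trans_eq ?_
      rw [prVec, 𝒜.Pr_shortcut B hdisj hB hs h0]
      simp only [Finset.sum_apply, Pi.smul_apply, smul_eq_mul]
      rw [← 𝒜.sum_shortAct B ⟨s, hs⟩ fun p => w p * p j]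
      simp only [hwa]
  · rintro ⟨p, hp, hqp⟩
    obtain ⟨w, hw0, hw1, rfl⟩ := Finset.mem_convexHull'.1 hp
    obtain ⟨ρ, hρ⟩ := (𝒜.shortcut B).M.exists_isSched
    set σ : Sched (Option S) (ShortAct 𝒜 B) := fun π a =>
      if π = ⟨some s, []⟩ then if a.1 ∈ B ⟨s, hs⟩ then w a.1 else 0 else ρ π a with hσdef
    have h0 : ∀ a, 0 ≤ σ ⟨some s, []⟩ a := by
      intro a
      simp only [hσdef, if_true]
      split_ifs with ha
      · exact hw0 _ ha
      · exact le_rfl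
    refine ⟨σ, fun π hπ => ?_, ?_⟩
    · by_cases hπs : π = ⟨some s, []⟩
      · subst hπs
        refine ⟨h0, fun a ha => (𝒜.enabled_shortcut_iff B hs a).2 ?_, fun _ => ?_⟩
        · by_contra hc
          simp [hσdef, hc] at ha
        · simp only [hσdef, if_true]
          rw [𝒜.sum_shortAct B ⟨s, hs⟩ w, hw1]
      · simpa [hσdef, hπs] using hρ π hπ
    · rintro ⟨t, ht⟩
      obtain ⟨j, hj, rfl⟩ := 𝒜.exists_mem_exit_of_mem_exit_shortcut B ht
      refine (hqp ⟨j, hj⟩).trans_eq ?_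
      rw [prVec, 𝒜.Pr_shortcut B hdisj hB hs h0 ⟨j, hj⟩]
      simp only [Finset.sum_apply, Pi.smul_apply, smul_eq_mul]
      rw [← 𝒜.sum_shortAct B ⟨s, hs⟩ fun p => w p * p ⟨j, hj⟩]
      refine Finset.sum_congr rfl fun a _ => ?_
      by_cases ha : a.1 ∈ B ⟨s, hs⟩ <;> simp [hσdef, ha]

theorem mem_achievable_shortcut_iff [Fintype S] [Fintype A] (hWF : 𝒜.WF)
    (hB : ∀ k, ∀ p ∈ B k, Subdist p)
    (hgen : ∀ k : 𝒜.EntrIdx, 𝒜.achievable k.1 = dwConv (B k : Set (𝒜.ExitIdx → ℝ)))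
    {s : S} (hs : s ∈ 𝒜.entr) (q : (𝒜.shortcut B).ExitIdx → ℝ) :
    q ∈ (𝒜.shortcut B).achievable (some s) ↔
      (fun j : 𝒜.ExitIdx => q ⟨some j.1, (𝒜.some_mem_exit_shortcut B _).2 j.2⟩) ∈
        𝒜.achievable s := by
  have hdisj : ∀ s ∈ 𝒜.entr, s ∉ 𝒜.exit := by
    have h := hWF.2.1
    rw [List.append_assoc (𝒜.Ir ++ 𝒜.Il)] at h
    exact fun s h₁ h₂ => (List.disjoint_of_nodup_append h) h₁ h₂
  have hne : (B ⟨s, hs⟩).Nonempty := by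
    obtain ⟨p, hp⟩ := 𝒜.achievable_nonempty s
    rw [hgen ⟨s, hs⟩] at hp
    obtain ⟨r, hr, -⟩ := hp
    exact Finset.coe_nonempty.1 (convexHull_nonempty_iff.1 ⟨r, hr⟩)
  rw [𝒜.mem_achievable_shortcut B hdisj (fun k p hp => (hB k p hp).1) hs hne, hgen ⟨s, hs⟩]

end Shortcut

end OMDP

theorem pullExit_surjective {S₁ A₁ S₂ A₂ : Type} (𝒳 : OMDP S₁ A₁) (𝒴 : OMDP S₂ A₂)
    {f : S₁ → S₂} (hf : ∀ s ∈ 𝒳.exit, f s ∈ 𝒴.exit) (hinj : f.Injective) :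
    (pullExit 𝒳 𝒴 f hf).Surjective := by
  have hi : (fun j : 𝒳.ExitIdx => (⟨f j.1, hf j.1 j.2⟩ : 𝒴.ExitIdx)).Injective :=
    fun j k h => Subtype.ext (hinj (Subtype.mk.inj h))
  exact fun p => ⟨Function.extend _ p 0, funext fun j => hi.extend_apply p 0 j⟩

end SD

open SD in
/-- For open MDPs `𝒜`, `ℬ`: the achievable sets of the sum
`𝒜 ⊕ ℬ` equal the achievable sets of `D(A^𝒜) ⊕ D(A^ℬ)`, where `D(A^𝒜)`,
`D(A^ℬ)` are the shortcut oMDPs of the vertex families `VA`, `VB` of the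
achievable sets of `𝒜` and `ℬ`: for every entrance `i` of `𝒜 ⊕ ℬ`,
`A^{𝒜⊕ℬ}(i) = A^{D(A^𝒜)⊕D(A^ℬ)}(i)` (achievable sets of the shortcut sum
transported along `s ↦ Sum.map some some s`). -/
theorem statement_9 {S₁ A₁ S₂ A₂ : Type}
    [Fintype S₁] [Fintype A₁] [Fintype S₂] [Fintype A₂]
    (𝒜 : OMDP S₁ A₁) (ℬ : OMDP S₂ A₂) (hWFA : 𝒜.WF) (hWFB : ℬ.WF)
    (VA : 𝒜.EntrIdx → Finset (𝒜.ExitIdx → ℝ))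
    (VB : ℬ.EntrIdx → Finset (ℬ.ExitIdx → ℝ))
    (hVA : ∀ k, ∀ p ∈ VA k, Subdist p) (hVB : ∀ k, ∀ p ∈ VB k, Subdist p)
    (hgenA : ∀ k : 𝒜.EntrIdx,
      𝒜.achievable k.1 = dwConv ((VA k : Finset (𝒜.ExitIdx → ℝ)) : Set (𝒜.ExitIdx → ℝ)))
    (hgenB : ∀ k : ℬ.EntrIdx,
      ℬ.achievable k.1 = dwConv ((VB k : Finset (ℬ.ExitIdx → ℝ)) : Set (ℬ.ExitIdx → ℝ)))
    (hmem : ∀ s ∈ (𝒜.sumComp ℬ).exit,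
      Sum.map some some s ∈ ((𝒜.shortcut VA).sumComp (ℬ.shortcut VB)).exit)
    (i : S₁ ⊕ S₂) (hi : i ∈ (𝒜.sumComp ℬ).entr) :
    (𝒜.sumComp ℬ).achievable i =
      pullExit (𝒜.sumComp ℬ) ((𝒜.shortcut VA).sumComp (ℬ.shortcut VB))
        (Sum.map some some) hmem ''
        ((𝒜.shortcut VA).sumComp (ℬ.shortcut VB)).achievable (Sum.map some some i) := by
  have hiff : ∀ q, q ∈ ((𝒜.shortcut VA).sumComp (ℬ.shortcut VB)).achievable
        (Sum.map some some i) ↔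
      pullExit (𝒜.sumComp ℬ) ((𝒜.shortcut VA).sumComp (ℬ.shortcut VB))
        (Sum.map some some) hmem q ∈ (𝒜.sumComp ℬ).achievable i := by
    intro q
    rcases i with s | s
    · have hs : s ∈ 𝒜.entr := by simpa [OMDP.entr, OMDP.sumComp] using hi
      rw [Sum.map_inl, OMDP.mem_achievable_of_isClosedEmbedding
          (OMDP.isClosedEmbedding_inl _ _) (OMDP.inl_mem_exit_sumComp _ _),
        OMDP.mem_achievable_of_isClosedEmbedding
          (OMDP.isClosedEmbedding_inl _ _) (OMDP.inl_mem_exit_sumComp _ _),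
        𝒜.mem_achievable_shortcut_iff VA hWFA hVA hgenA hs]
      refine and_congr Iff.rfl ⟨fun h o ho => h _ ?_, ?_⟩
      · obtain ⟨o | o, h⟩ := o
        · exact absurd ⟨o, rfl⟩ ho
        · simp
      · rintro h ⟨o | o, h'⟩ ho
        · exact absurd ⟨o, rfl⟩ ho
        · obtain ⟨u, hu, rfl⟩ := ℬ.exists_mem_exit_of_mem_exit_shortcut VB
            ((OMDP.inr_mem_exit_sumComp _ _ _).1 h')
          exact h ⟨Sum.inr u, (OMDP.inr_mem_exit_sumComp _ _ _).2 hu⟩ (by simp)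
    · have hs : s ∈ ℬ.entr := by simpa [OMDP.entr, OMDP.sumComp] using hi
      rw [Sum.map_inr, OMDP.mem_achievable_of_isClosedEmbedding
          (OMDP.isClosedEmbedding_inr _ _) (OMDP.inr_mem_exit_sumComp _ _),
        OMDP.mem_achievable_of_isClosedEmbedding
          (OMDP.isClosedEmbedding_inr _ _) (OMDP.inr_mem_exit_sumComp _ _),
        ℬ.mem_achievable_shortcut_iff VB hWFB hVB hgenB hs]
      refine and_congr Iff.rfl ⟨fun h o ho => h _ ?_, ?_⟩
      · obtain ⟨o | o, h⟩ := o
        · simp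
        · exact absurd ⟨o, rfl⟩ ho
      · rintro h ⟨o | o, h'⟩ ho
        · obtain ⟨u, hu, rfl⟩ := 𝒜.exists_mem_exit_of_mem_exit_shortcut VA
            ((OMDP.inl_mem_exit_sumComp _ _ _).1 h')
          exact h ⟨Sum.inl u, (OMDP.inl_mem_exit_sumComp _ _ _).2 hu⟩ (by simp)
        · exact absurd ⟨o, rfl⟩ ho
  rw [Set.ext hiff]
  exact (Set.image_preimage_eq _ (pullExit_surjective _ _ hmem
    (Sum.map_injective.2 ⟨Option.some_injective _, Option.some_injective _⟩))).symm
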